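/- arXiv:2109.11601 — 2 statements merged into one kernel-verified Lean document; each statement's English description precedes it below -/
import Mathlib

section
/- The semigroup MP of all monomial maps z ↦ λ z^n of ℂ (λ ∈ ℂ \ {0}, n ≥ 1), with composition as the operation, is amenable: it admits a mean that is simultaneously left and right invariant. -/
/-- A real-valued function on `σ` is bounded. -/
def Bdd {σ : Type*} (f : σ → ℝ) : Prop := ∃ C : ℝ, ∀ s, |f s| ≤ C

/-- A mean on `σ`: a normalized positive real-linear functional on the space `ℓ∞(σ)`
of bounded real-valued functions on `σ`. -/
structure Mean (σ : Type*) where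
  toFun : (σ → ℝ) → ℝ
  map_add' : ∀ f g : σ → ℝ, Bdd f → Bdd g → toFun (f + g) = toFun f + toFun g
  map_smul' : ∀ (c : ℝ) (f : σ → ℝ), Bdd f → toFun (c • f) = c * toFun f
  nonneg' : ∀ f : σ → ℝ, Bdd f → (∀ s, 0 ≤ f s) → 0 ≤ toFun f
  one' : toFun (fun _ => (1 : ℝ)) = 1

/-- `M` is a left invariant mean on a set `S` of self-maps of `α`, regarded as a
semigroup with product `g·h := g ∘ h`:  `M (g ↦ f (h ∘ g)) = M f` for all `h ∈ S`
and all bounded `f`. -/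
def MapLeftInv {α : Type*} (S : Set (α → α)) (M : Mean S) : Prop :=
  ∀ (h : S) (hc : ∀ g : S, (h : α → α) ∘ (g : α → α) ∈ S),
    ∀ f : S → ℝ, Bdd f →
      M.toFun (fun g : S => f ⟨(h : α → α) ∘ (g : α → α), hc g⟩) = M.toFun f

/-- `M` is a right invariant mean on a set `S` of self-maps of `α` under composition:
`M (g ↦ f (g ∘ h)) = M f` for all `h ∈ S` and all bounded `f`. -/
def MapRightInv {α : Type*} (S : Set (α → α)) (M : Mean S) : Prop :=
  ∀ (h : S) (hc : ∀ g : S, (g : α → α) ∘ (h : α → α) ∈ S),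
    ∀ f : S → ℝ, Bdd f →
      M.toFun (fun g : S => f ⟨(g : α → α) ∘ (h : α → α), hc g⟩) = M.toFun f

/-- The semigroup `MP` of all monomial maps `z ↦ λ zⁿ` of `ℂ`, `λ ≠ 0`, `n ≥ 1`. -/
def MPset : Set (ℂ → ℂ) :=
  {f | ∃ lam : ℂ, lam ≠ 0 ∧ ∃ n : ℕ, 1 ≤ n ∧ f = fun z => lam * z ^ n}

open Filter Topology

/-- Translation of functions on a commutative monoid. -/
def translation {G : Type*} [CommMonoid G] (a : G) : Module.End ℝ (G → ℝ) where
  toFun f x := f (a * x)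
  map_add' _ _ := rfl
  map_smul' _ _ := rfl

/-- The average of the first `n + 1` iterates of the translation by `a`. -/
noncomputable def translationAverage {G : Type*} [CommMonoid G] (p : G × ℕ) :
    Module.End ℝ (G → ℝ) :=
  ((p.2 + 1 : ℕ) : ℝ)⁻¹ • ∑ i ∈ Finset.range (p.2 + 1), translation p.1 ^ i

theorem translation_pow_apply {G : Type*} [CommMonoid G] (a : G) (n : ℕ) (f : G → ℝ) (x : G) :
    (translation a ^ n) f x = f (a ^ n * x) := by
  induction n generalizing x with
  | zero => simp
  | succ n ih =>
    rw [pow_succ', Module.End.mul_apply]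
    change (translation a ^ n) f (a * x) = _
    rw [ih, pow_succ, mul_assoc]

theorem translation_commute {G : Type*} [CommMonoid G] (a b : G) :
    Commute (translation a) (translation b) := by
  refine LinearMap.ext fun f => funext fun x => ?_
  change f (b * (a * x)) = f (a * (b * x))
  rw [mul_left_comm]

theorem translationAverage_commute {G : Type*} [CommMonoid G] (p q : G × ℕ) :
    Commute (translationAverage p) (translationAverage q) := by
  unfold translationAverage
  refine Commute.smul_left (Commute.smul_right ?_ _) _
  exact Commute.sum_left _ _ _ fun i _ => Commute.sum_right _ _ _ fun j _ =>
    (translation_commute _ _).pow_pow i j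

theorem translationAverage_apply_le {G : Type*} [CommMonoid G] (p : G × ℕ) {f : G → ℝ} {c : ℝ}
    (hf : ∀ x, f x ≤ c) (x : G) : translationAverage p f x ≤ c := by
  have h : translationAverage p f x =
      ((p.2 + 1 : ℕ) : ℝ)⁻¹ * ∑ i ∈ Finset.range (p.2 + 1), f (p.1 ^ i * x) := by
    simp [translationAverage, translation_pow_apply]
  have hs : ∑ i ∈ Finset.range (p.2 + 1), f (p.1 ^ i * x) ≤ ((p.2 + 1 : ℕ) : ℝ) * c := by
    simpa using Finset.sum_le_card_nsmul (Finset.range (p.2 + 1)) _ c fun i _ => hf (p.1 ^ i * x)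
  rw [h, inv_mul_le_iff₀ (by positivity)]
  exact hs

theorem translationAverage_sub_translation_apply {G : Type*} [CommMonoid G] (a : G) (n : ℕ)
    (f : G → ℝ) (x : G) :
    translationAverage (a, n) (translation a f - f) x =
      ((n + 1 : ℕ) : ℝ)⁻¹ * (f (a ^ (n + 1) * x) - f x) := by
  have h : translationAverage (a, n) * (translation a - 1) =
      ((n + 1 : ℕ) : ℝ)⁻¹ • (translation a ^ (n + 1) - 1) := by
    rw [translationAverage, smul_mul_assoc, geom_sum_mul]
  have := congrFun (LinearMap.congr_fun h f) x
  simpa [translation_pow_apply] using this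

/-- The monoid of operators generated by the translation averages. -/
noncomputable def averagingMonoid (G : Type*) [CommMonoid G] :
    Submonoid (Module.End ℝ (G → ℝ)) :=
  Submonoid.closure (Set.range translationAverage)

theorem averagingMonoid_apply_le {G : Type*} [CommMonoid G] (A : averagingMonoid G) {f : G → ℝ}
    {c : ℝ} (hf : ∀ x, f x ≤ c) (x : G) : (A : Module.End ℝ (G → ℝ)) f x ≤ c := by
  obtain ⟨A, hA⟩ := A
  induction hA using Submonoid.closure_induction generalizing f x with
  | mem A h =>
    obtain ⟨p, rfl⟩ := h
    exact translationAverage_apply_le p hf x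
  | one => exact hf x
  | mul A B _ _ ihA ihB => exact ihA (fun y => ihB hf y) x

theorem le_averagingMonoid_apply {G : Type*} [CommMonoid G] (A : averagingMonoid G) {f : G → ℝ}
    {c : ℝ} (hf : ∀ x, c ≤ f x) (x : G) : c ≤ (A : Module.End ℝ (G → ℝ)) f x := by
  have := averagingMonoid_apply_le A (f := -f) (c := -c) (fun y => neg_le_neg (hf y)) x
  simpa using this

theorem averagingMonoid_mul_comm {G : Type*} [CommMonoid G] (A B : averagingMonoid G) :
    A * B = B * A := by
  have : IsMulCommutative (averagingMonoid G) := Submonoid.isMulCommutative_closure _ (by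
    rintro _ ⟨p, rfl⟩ _ ⟨q, rfl⟩
    exact translationAverage_commute p q)
  exact mul_comm' A B

theorem exists_ultrafilter_averagingMonoid (G : Type*) [CommMonoid G] :
    ∃ U : Ultrafilter (averagingMonoid G), ∀ A, ∀ᶠ B in (U : Filter (averagingMonoid G)), A ∣ B := by
  have hd : Directed (· ≥ ·) fun A : averagingMonoid G => 𝓟 {B | A ∣ B} := fun A B =>
    ⟨A * B, principal_mono.2 fun C hC => (Dvd.intro B rfl).trans hC,
      principal_mono.2 fun C hC =>
        (Dvd.intro A (averagingMonoid_mul_comm B A)).trans hC⟩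
  have : (⨅ A : averagingMonoid G, 𝓟 {B | A ∣ B}).NeBot :=
    iInf_neBot_of_directed' hd fun A => principal_neBot_iff.2 ⟨A, dvd_rfl⟩
  exact ⟨Ultrafilter.of _, fun A =>
    Ultrafilter.of_le _ (mem_iInf_of_mem A (mem_principal_self _))⟩

theorem exists_mean_mul_invariant (G : Type*) [CommMonoid G] :
    ∃ M : Mean G, ∀ (a : G) (f : G → ℝ), Bdd f → M.toFun (fun x => f (a * x)) = M.toFun f := by
  obtain ⟨U, hU⟩ := exists_ultrafilter_averagingMonoid G
  let φ : (G → ℝ) → averagingMonoid G → ℝ := fun f A => (A : Module.End ℝ (G → ℝ)) f 1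
  have hlim : ∀ f, Bdd f → Tendsto (φ f) U (𝓝 (limUnder U (φ f))) := by
    rintro f ⟨C, hC⟩
    have hmem : (U.map (φ f) : Filter ℝ) ≤ 𝓟 (Set.Icc (-C) C) := by
      refine le_principal_iff.2 (Ultrafilter.mem_map.2 (univ_mem' fun A => ?_))
      exact ⟨le_averagingMonoid_apply A (fun y => (abs_le.1 (hC y)).1) 1,
        averagingMonoid_apply_le A (fun y => (abs_le.1 (hC y)).2) 1⟩
    obtain ⟨x, -, hx⟩ := isCompact_Icc.ultrafilter_le_nhds _ hmem
    exact tendsto_nhds_limUnder ⟨x, hx⟩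
  have hadd : ∀ f g : G → ℝ, Bdd f → Bdd g →
      limUnder U (φ (f + g)) = limUnder U (φ f) + limUnder U (φ g) := fun f g hf hg =>
    (((hlim f hf).add (hlim g hg)).congr fun A => by simp [φ]).limUnder_eq
  refine ⟨⟨fun f => limUnder U (φ f), hadd, ?_, ?_, ?_⟩, ?_⟩
  · exact fun c f hf => (((hlim f hf).const_mul c).congr fun A => by simp [φ]).limUnder_eq
  · exact fun f hf h0 => ge_of_tendsto' (hlim f hf) fun A => le_averagingMonoid_apply A h0 1
  · refine (tendsto_const_nhds.congr fun A => ?_).limUnder_eq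
    exact le_antisymm (le_averagingMonoid_apply A (fun _ => le_rfl) 1)
      (averagingMonoid_apply_le A (fun _ => le_rfl) 1)
  · rintro a f ⟨C, hC⟩
    have hta : Tendsto (fun A => φ (translation a f) A - φ f A) U (𝓝 0) := by
      rw [Metric.tendsto_nhds]
      intro ε hε
      obtain ⟨n, hn⟩ := exists_nat_gt (2 * C / ε)
      filter_upwards [hU ⟨translationAverage (a, n), Submonoid.subset_closure ⟨_, rfl⟩⟩]
      rintro _ ⟨B, rfl⟩
      have hb : ∀ x, |translationAverage (a, n) (translation a f - f) x| ≤
          ((n + 1 : ℕ) : ℝ)⁻¹ * (2 * C) := by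
        intro x
        rw [translationAverage_sub_translation_apply, abs_mul, abs_of_nonneg (by positivity)]
        gcongr
        have h1 := abs_le.1 (hC (a ^ (n + 1) * x))
        have h2 := abs_le.1 (hC x)
        exact abs_le.2 ⟨by linarith, by linarith⟩
      have hlt : ((n + 1 : ℕ) : ℝ)⁻¹ * (2 * C) < ε := by
        rw [inv_mul_lt_iff₀ (by positivity)]
        rw [div_lt_iff₀ hε] at hn
        push_cast
        nlinarith
      rw [averagingMonoid_mul_comm, Real.dist_0_eq_abs]
      have heq : ∀ A : averagingMonoid G,
          φ (translation a f) A - φ f A = φ (translation a f - f) A := fun A => by simp [φ]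
      rw [heq]
      refine lt_of_le_of_lt (abs_le.2 ⟨?_, ?_⟩) hlt
      · exact le_averagingMonoid_apply B (fun y => (abs_le.1 (hb y)).1) 1
      · exact averagingMonoid_apply_le B (fun y => (abs_le.1 (hb y)).2) 1
    have h := tendsto_nhds_unique hta
      ((hlim (translation a f) ⟨C, fun x => hC (a * x)⟩).sub (hlim f ⟨C, hC⟩))
    exact sub_eq_zero.1 h.symm

theorem Mean.toFun_const {σ : Type*} (M : Mean σ) (c : ℝ) : M.toFun (fun _ => c) = c := by
  have h := M.map_smul' c (fun _ => 1) ⟨1, fun _ => by simp⟩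
  rw [M.one', mul_one] at h
  refine Eq.trans (congrArg M.toFun (funext fun s => ?_)) h
  simp

theorem Mean.toFun_mono {σ : Type*} (M : Mean σ) {f g : σ → ℝ} (hf : Bdd f) (hg : Bdd g)
    (h : ∀ s, f s ≤ g s) : M.toFun f ≤ M.toFun g := by
  have hd : Bdd (g - f) := by
    obtain ⟨C, hC⟩ := hf
    obtain ⟨D, hD⟩ := hg
    exact ⟨D + C, fun s => (abs_sub _ _).trans (add_le_add (hD s) (hC s))⟩
  have h1 := M.map_add' f (g - f) hf hd
  have h2 := M.nonneg' (g - f) hd fun s => sub_nonneg.2 (h s)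
  rw [add_sub_cancel] at h1
  linarith

theorem Mean.abs_toFun_le {σ : Type*} (M : Mean σ) {f : σ → ℝ} {C : ℝ} (hf : ∀ s, |f s| ≤ C) :
    |M.toFun f| ≤ C := by
  have h1 := M.toFun_mono (f := fun _ => -C) ⟨|C|, fun _ => by simp⟩ ⟨C, hf⟩
    fun s => (abs_le.1 (hf s)).1
  have h2 := M.toFun_mono (g := fun _ => C) ⟨C, hf⟩ ⟨|C|, fun _ => by simp⟩
    fun s => (abs_le.1 (hf s)).2
  rw [M.toFun_const] at h1 h2
  exact abs_le.2 ⟨h1, h2⟩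

/-- The image under `e` of the product of two means, `N` being evaluated first. -/
def Mean.map₂ {σ τ ρ : Type*} (e : σ → τ → ρ) (M : Mean σ) (N : Mean τ) : Mean ρ where
  toFun f := M.toFun fun s => N.toFun fun t => f (e s t)
  map_add' := by
    rintro f g ⟨C, hC⟩ ⟨D, hD⟩
    rw [← M.map_add' _ _ ⟨C, fun s => N.abs_toFun_le fun t => hC _⟩
      ⟨D, fun s => N.abs_toFun_le fun t => hD _⟩]
    congr 1
    ext s
    exact N.map_add' _ _ ⟨C, fun t => hC _⟩ ⟨D, fun t => hD _⟩
  map_smul' := by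
    rintro c f ⟨C, hC⟩
    rw [← M.map_smul' _ _ ⟨C, fun s => N.abs_toFun_le fun t => hC _⟩]
    congr 1
    ext s
    exact N.map_smul' _ _ ⟨C, fun t => hC _⟩
  nonneg' := by
    rintro f ⟨C, hC⟩ h0
    exact M.nonneg' _ ⟨C, fun s => N.abs_toFun_le fun t => hC _⟩
      fun s => N.nonneg' _ ⟨C, fun t => hC _⟩ fun t => h0 _
  one' := by simp only [N.one', M.one']

theorem exists_mean_units_mul_pow_invariant :
    ∃ M : Mean ℂˣ, (∀ (a : ℂˣ) (f : ℂˣ → ℝ), Bdd f → M.toFun (fun x => f (a * x)) = M.toFun f) ∧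
      ∀ (p : ℕ+) (f : ℂˣ → ℝ), Bdd f → M.toFun (fun x => f (x ^ (p : ℕ))) = M.toFun f := by
  obtain ⟨M, hM⟩ := exists_mean_mul_invariant ℂˣ
  obtain ⟨N, hN⟩ := exists_mean_mul_invariant ℕ+
  refine ⟨Mean.map₂ (fun (n : ℕ+) x => x ^ (n : ℕ)) N M, ?_, ?_⟩
  · rintro a f ⟨C, hC⟩
    refine congrArg N.toFun (funext fun n => ?_)
    obtain ⟨z, hz⟩ := IsAlgClosed.exists_pow_nat_eq (a : ℂ) n.pos
    have hz0 : z ≠ 0 := by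
      rintro rfl
      exact a.ne_zero (by rw [← hz, zero_pow n.ne_zero])
    have ha : a = Units.mk0 z hz0 ^ (n : ℕ) := Units.ext (by simp [hz])
    rw [ha, ← hM (Units.mk0 z hz0) (fun x => f (x ^ (n : ℕ))) ⟨C, fun _ => hC _⟩]
    simp only [mul_pow]
  · rintro p f ⟨C, hC⟩
    refine Eq.trans ?_ (hN p (fun n => M.toFun fun x => f (x ^ (n : ℕ)))
      ⟨C, fun n => M.abs_toFun_le fun _ => hC _⟩)
    refine congrArg N.toFun (funext fun n => congrArg M.toFun (funext fun x => ?_))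
    simp only [← pow_mul, mul_comm p n, PNat.mul_coe]

/-- The monomial map `z ↦ x zⁿ`. -/
def monomialMap (n : ℕ+) (x : ℂˣ) : MPset :=
  ⟨fun z => x * z ^ (n : ℕ), x, x.ne_zero, n, n.pos, rfl⟩

theorem monomialMap_comp (n k : ℕ+) (x y : ℂˣ) :
    (monomialMap n x : ℂ → ℂ) ∘ (monomialMap k y : ℂ → ℂ) =
      monomialMap (n * k) (x * y ^ (n : ℕ)) := by
  ext z
  simp [monomialMap]
  ring

theorem exists_eq_monomialMap (h : MPset) : ∃ n x, h = monomialMap n x := by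
  obtain ⟨_, a, ha, n, hn, rfl⟩ := h
  exact ⟨⟨n, hn⟩, Units.mk0 a ha, rfl⟩

/-- The semigroup `MP` of all monomial maps of `ℂ` under composition is amenable:
it admits a mean that is simultaneously left and right invariant. -/
theorem MP_amenable :
    ∃ M : Mean MPset, MapLeftInv MPset M ∧ MapRightInv MPset M := by
  obtain ⟨M, hmul, hpow⟩ := exists_mean_units_mul_pow_invariant
  obtain ⟨N, hN⟩ := exists_mean_mul_invariant ℕ+
  refine ⟨Mean.map₂ monomialMap N M, ?_, ?_⟩
  · rintro h hc f ⟨C, hC⟩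
    obtain ⟨n, x, rfl⟩ := exists_eq_monomialMap h
    refine Eq.trans ?_ (hN n (fun k => M.toFun fun y => f (monomialMap k y))
      ⟨C, fun k => M.abs_toFun_le fun _ => hC _⟩)
    refine congrArg N.toFun (funext fun k => ?_)
    rw [← hmul x (fun y => f (monomialMap (n * k) y)) ⟨C, fun _ => hC _⟩,
      ← hpow n (fun y => f (monomialMap (n * k) (x * y))) ⟨C, fun _ => hC _⟩]
    exact congrArg M.toFun (funext fun y => congrArg f (Subtype.ext (monomialMap_comp n k x y)))
  · rintro h hc f ⟨C, hC⟩
    obtain ⟨n, x, rfl⟩ := exists_eq_monomialMap h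
    refine Eq.trans ?_ (hN n (fun k => M.toFun fun y => f (monomialMap k y))
      ⟨C, fun k => M.abs_toFun_le fun _ => hC _⟩)
    refine congrArg N.toFun (funext fun k => ?_)
    rw [← hmul (x ^ (k : ℕ)) (fun y => f (monomialMap (n * k) y)) ⟨C, fun _ => hC _⟩]
    refine congrArg M.toFun (funext fun y => congrArg f (Subtype.ext ?_))
    rw [mul_comm n k, mul_comm _ y]
    exact monomialMap_comp k n y x
end

section
/- Let U be a subsemigroup of H = {z ↦ λz : λ ∈ ℂ \ {0}} and let T be a subsemigroup of Z = {z ↦ z^n : n ≥ 1} (both under composition), and let S = ⟨U, T⟩ be the semigroup they generate under composition. Then S is right amenable. -/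
/-- The subsemigroup (under composition) of self-maps generated by a set `G`:
the smallest set containing `G` and closed under composition. -/
inductive GenSG {α : Type*} (G : Set (α → α)) : (α → α) → Prop
  | base {f : α → α} (hf : f ∈ G) : GenSG G f
  | comp {f g : α → α} (hf : GenSG G f) (hg : GenSG G g) : GenSG G (f ∘ g)

/-- The group of homotheties `H = {z ↦ λz : λ ∈ ℂ \ {0}}`. -/
def Hset : Set (ℂ → ℂ) := {f | ∃ lam : ℂ, lam ≠ 0 ∧ f = fun z => lam * z}

/-- The semigroup of power maps `Z = {z ↦ zⁿ : n ≥ 1}`. -/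
def Zset : Set (ℂ → ℂ) := {f | ∃ n : ℕ, 1 ≤ n ∧ f = fun z => z ^ n}

theorem Bdd.comp {σ τ : Type*} {f : σ → ℝ} (hf : Bdd f) (φ : τ → σ) :
    Bdd (fun x => f (φ x)) :=
  hf.imp fun _ hC x => hC (φ x)

theorem Bdd.add {σ : Type*} {f g : σ → ℝ} (hf : Bdd f) (hg : Bdd g) : Bdd (f + g) := by
  obtain ⟨C, hC⟩ := hf
  obtain ⟨D, hD⟩ := hg
  exact ⟨C + D, fun x => (abs_add_le _ _).trans (add_le_add (hC x) (hD x))⟩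

theorem Bdd.smul {σ : Type*} {f : σ → ℝ} (hf : Bdd f) (c : ℝ) : Bdd (c • f) := by
  obtain ⟨C, hC⟩ := hf
  refine ⟨|c| * C, fun x => ?_⟩
  simpa [abs_mul] using mul_le_mul_of_nonneg_left (hC x) (abs_nonneg c)

theorem bdd_const {σ : Type*} (c : ℝ) : Bdd (fun _ : σ => c) := ⟨|c|, fun _ => le_rfl⟩

namespace Mean

variable {σ : Type*}

theorem map_const (M : Mean σ) (c : ℝ) : M.toFun (fun _ => c) = c := by
  have h := M.map_smul' c (fun _ => 1) (bdd_const 1)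
  rw [M.one', mul_one] at h
  convert h using 2
  ext x
  simp

theorem map_sub (M : Mean σ) {f g : σ → ℝ} (hf : Bdd f) (hg : Bdd g) :
    M.toFun (f - g) = M.toFun f - M.toFun g := by
  have h : f - g = f + (-1 : ℝ) • g := by ext x; simp [sub_eq_add_neg]
  rw [h, M.map_add' _ _ hf (hg.smul _), M.map_smul' _ _ hg]
  ring

theorem mono (M : Mean σ) {f g : σ → ℝ} (hf : Bdd f) (hg : Bdd g) (h : ∀ x, f x ≤ g x) :
    M.toFun f ≤ M.toFun g := by
  have hb : Bdd (g - f) := by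
    simpa [sub_eq_add_neg] using hg.add (hf.smul (-1))
  have h0 := M.nonneg' (g - f) hb fun x => sub_nonneg.2 (h x)
  rw [M.map_sub hg hf] at h0
  linarith

theorem abs_le (M : Mean σ) {f : σ → ℝ} {C : ℝ} (hC : ∀ x, |f x| ≤ C) : |M.toFun f| ≤ C := by
  have hf : Bdd f := ⟨C, hC⟩
  refine _root_.abs_le.2 ⟨?_, ?_⟩
  · rw [← M.map_const (-C)]
    exact M.mono (bdd_const _) hf fun x => (_root_.abs_le.1 (hC x)).1
  · rw [← M.map_const C]
    exact M.mono hf (bdd_const _) fun x => (_root_.abs_le.1 (hC x)).2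

/-- Means are compact: an ultrafilter of means converges pointwise on bounded functions. -/
theorem exists_tendsto_ultrafilter {ι : Type*} (F : Ultrafilter ι) (M : ι → Mean σ) :
    ∃ L : Mean σ, ∀ f, Bdd f →
      Filter.Tendsto (fun i => (M i).toFun f) F (nhds (L.toFun f)) := by
  have hlim (f : σ → ℝ) :
      ∃ x, Bdd f → Filter.Tendsto (fun i => (M i).toFun f) F (nhds x) := by
    by_cases hf : Bdd f
    swap
    · exact ⟨0, fun h => absurd h hf⟩
    obtain ⟨C, hC⟩ := hf
    obtain ⟨x, -, hx⟩ := (isCompact_Icc (a := -C) (b := C)).ultrafilter_le_nhds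
      (F.map fun i => (M i).toFun f) (by
        rw [Ultrafilter.coe_map, Filter.le_principal_iff]
        exact Filter.mem_map.2 <| Filter.Eventually.of_forall fun i =>
          _root_.abs_le.1 ((M i).abs_le hC))
    exact ⟨x, fun _ => hx⟩
  choose L key using hlim
  refine ⟨⟨L, ?_, ?_, ?_, ?_⟩, key⟩
  · intro f g hf hg
    refine tendsto_nhds_unique (key _ (hf.add hg)) ?_
    simpa only [(M _).map_add' f g hf hg] using (key f hf).add (key g hg)
  · intro c f hf
    refine tendsto_nhds_unique (key _ (hf.smul c)) ?_
    simpa only [(M _).map_smul' c f hf] using (key f hf).const_mul c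
  · intro f hf h
    exact ge_of_tendsto' (key f hf) fun i => (M i).nonneg' f hf h
  · refine tendsto_nhds_unique (key _ (bdd_const 1)) ?_
    simpa only [(M _).one'] using tendsto_const_nhds

/-- The push-forward of a mean. -/
def map {τ : Type*} (M : Mean σ) (φ : σ → τ) : Mean τ where
  toFun f := M.toFun fun x => f (φ x)
  map_add' _ _ hf hg := M.map_add' _ _ (hf.comp φ) (hg.comp φ)
  map_smul' c _ hf := M.map_smul' c _ (hf.comp φ)
  nonneg' _ hf h := M.nonneg' _ (hf.comp φ) fun x => h (φ x)
  one' := M.one'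

/-- The iterated mean `f ↦ M (a ↦ N (b ↦ f (φ b a)))`. -/
def bind {τ υ : Type*} (M : Mean σ) (N : Mean τ) (φ : τ → σ → υ) : Mean υ where
  toFun f := M.toFun fun a => N.toFun fun b => f (φ b a)
  map_add' f g hf hg := by
    have h (k : υ → ℝ) (hk : Bdd k) : Bdd fun a => N.toFun fun b => k (φ b a) :=
      hk.imp fun C hC a => N.abs_le fun b => hC (φ b a)
    rw [← M.map_add' _ _ (h f hf) (h g hg)]
    congr 1
    ext a
    exact N.map_add' _ _ (hf.comp _) (hg.comp _)
  map_smul' c f hf := by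
    have h : Bdd fun a => N.toFun fun b => f (φ b a) :=
      hf.imp fun C hC a => N.abs_le fun b => hC (φ b a)
    rw [← M.map_smul' _ _ h]
    congr 1
    ext a
    exact N.map_smul' c _ (hf.comp _)
  nonneg' f hf h := by
    refine M.nonneg' _ ?_ fun a => N.nonneg' _ (hf.comp _) fun b => h _
    exact hf.imp fun C hC a => N.abs_le fun b => hC (φ b a)
  one' := by simp only [N.one', M.one']

/-- The Cesàro average of the push-forwards of a mean under the first `n + 1` iterates of a
map. -/
noncomputable def cesaro (M : Mean σ) (φ : σ → σ) (n : ℕ) : Mean σ where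
  toFun f := (∑ i ∈ Finset.range (n + 1), (M.map φ^[i]).toFun f) / (n + 1)
  map_add' f g hf hg := by
    simp only [(M.map _).map_add' f g hf hg, Finset.sum_add_distrib, add_div]
  map_smul' c f hf := by
    simp only [(M.map _).map_smul' c f hf, ← Finset.mul_sum, mul_div_assoc]
  nonneg' f hf h :=
    div_nonneg (Finset.sum_nonneg fun i _ => (M.map _).nonneg' f hf h) (by positivity)
  one' := by
    simp only [(M.map _).one', Finset.sum_const, Finset.card_range, nsmul_eq_mul, mul_one]
    push_cast
    exact div_self (by positivity)

theorem tendsto_cesaro_sub (M : Mean σ) (φ : σ → σ) {f : σ → ℝ} (hf : Bdd f) :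
    Filter.Tendsto (fun n => (M.cesaro φ n).toFun (fun x => f (φ x)) - (M.cesaro φ n).toFun f)
      Filter.atTop (nhds 0) := by
  obtain ⟨C, hC⟩ := hf
  have h (n : ℕ) : (M.cesaro φ n).toFun (fun x => f (φ x)) - (M.cesaro φ n).toFun f =
      ((M.map φ^[n + 1]).toFun f - (M.map φ^[0]).toFun f) / ((n : ℝ) + 1) := by
    rw [← Finset.sum_range_sub (fun i => (M.map φ^[i]).toFun f), Finset.sum_sub_distrib, sub_div]
    simp only [cesaro, map, Function.iterate_succ_apply']
  refine squeeze_zero_norm (a := fun n : ℕ => (2 * C) * (1 / ((n : ℝ) + 1))) (fun n => ?_) ?_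
  · rw [h, Real.norm_eq_abs, abs_div, abs_of_pos (show (0 : ℝ) < n + 1 by positivity),
      mul_one_div]
    gcongr
    have h1 := (M.map φ^[n + 1]).abs_le hC
    have h2 := (M.map φ^[0]).abs_le hC
    linarith [abs_sub ((M.map φ^[n + 1]).toFun f) ((M.map φ^[0]).toFun f)]
  · simpa using tendsto_one_div_add_atTop_nhds_zero_nat.const_mul (2 * C)

/-- `M` is invariant under the self-map `φ`. -/
def Invariant (M : Mean σ) (φ : σ → σ) : Prop :=
  ∀ f, Bdd f → M.toFun (fun x => f (φ x)) = M.toFun f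

theorem Invariant.cesaro {M : Mean σ} {φ ψ : σ → σ} (h : M.Invariant ψ)
    (hc : Function.Commute φ ψ) (n : ℕ) : (M.cesaro φ n).Invariant ψ := by
  intro f hf
  simp only [Mean.cesaro, map]
  congr 1
  refine Finset.sum_congr rfl fun i _ => ?_
  rw [← h _ (hf.comp φ^[i])]
  simp only [(hc.iterate_left i).eq]

theorem exists_invariant_of_commute (M : Mean σ) (φ : σ → σ) :
    ∃ L : Mean σ, L.Invariant φ ∧
      ∀ ψ, Function.Commute φ ψ → M.Invariant ψ → L.Invariant ψ := by
  obtain ⟨L, hL⟩ := exists_tendsto_ultrafilter (Filter.hyperfilter ℕ) (M.cesaro φ)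
  refine ⟨L, fun f hf => ?_, fun ψ hc h f hf => ?_⟩
  · have h1 := (hL _ (hf.comp φ)).sub (hL f hf)
    have h2 := (M.tendsto_cesaro_sub φ hf).mono_left Nat.hyperfilter_le_atTop
    exact sub_eq_zero.1 (tendsto_nhds_unique h1 h2)
  · refine tendsto_nhds_unique (hL _ (hf.comp ψ)) ?_
    simpa only [(h.cesaro hc _) f hf] using hL f hf

/-- Evaluation at a point. -/
def dirac (x : σ) : Mean σ where
  toFun f := f x
  map_add' _ _ _ _ := rfl
  map_smul' _ _ _ := rfl
  nonneg' _ _ h := h x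
  one' := rfl

/-- A family of pairwise commuting self-maps of a nonempty set has an invariant mean. -/
theorem exists_invariant_of_pairwise_commute [Nonempty σ] {ι : Type*} (φ : ι → σ → σ)
    (hc : ∀ i j, Function.Commute (φ i) (φ j)) : ∃ M : Mean σ, ∀ i, M.Invariant (φ i) := by
  classical
  have hfin (s : Finset ι) : ∃ M : Mean σ, ∀ i ∈ s, M.Invariant (φ i) := by
    induction s using Finset.induction_on with
    | empty => exact ⟨dirac (Classical.arbitrary σ), by simp⟩
    | insert a s _ ih =>
      obtain ⟨M, hM⟩ := ih
      obtain ⟨L, hL, hL'⟩ := M.exists_invariant_of_commute (φ a)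
      refine ⟨L, fun i hi => ?_⟩
      rcases Finset.mem_insert.1 hi with rfl | hi
      · exact hL
      · exact hL' _ (hc a i) (hM i hi)
  choose M hM using hfin
  obtain ⟨L, hL⟩ := exists_tendsto_ultrafilter (Ultrafilter.of Filter.atTop) M
  refine ⟨L, fun i f hf => tendsto_nhds_unique (hL _ (hf.comp (φ i))) ((hL f hf).congr' ?_)⟩
  refine Ultrafilter.of_le Filter.atTop ?_
  filter_upwards [Filter.eventually_ge_atTop {i}] with s hs
  exact (hM s i (hs (Finset.mem_singleton_self i)) f hf).symm

end Mean

/-- A commutative semigroup of self-maps is right amenable. -/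
theorem exists_mapRightInv_of_comm {α : Type*} {S : Set (α → α)} (hne : S.Nonempty)
    (hcomp : ∀ f ∈ S, ∀ g ∈ S, f ∘ g ∈ S) (hcomm : ∀ f ∈ S, ∀ g ∈ S, f ∘ g = g ∘ f) :
    ∃ M : Mean S, MapRightInv S M := by
  have := hne.to_subtype
  obtain ⟨M, hM⟩ := Mean.exists_invariant_of_pairwise_commute
    (fun h g : S => (⟨g.1 ∘ h.1, hcomp _ g.2 _ h.2⟩ : S)) fun a b g => Subtype.ext <| by
      change (g.1 ∘ b.1) ∘ a.1 = (g.1 ∘ a.1) ∘ b.1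
      rw [Function.comp_assoc, Function.comp_assoc, hcomm _ b.2 _ a.2]
  exact ⟨M, fun h _ => hM h⟩

/-- Right invariance needs only be checked on generators. -/
theorem mapRightInv_genSG {α : Type*} {G : Set (α → α)} {M : Mean (setOf (GenSG G))}
    (hM : ∀ (h : α → α) (hh : h ∈ G),
      M.Invariant fun g => ⟨g.1 ∘ h, GenSG.comp g.2 (.base hh)⟩) :
    MapRightInv (setOf (GenSG G)) M := by
  have key (h : α → α) (hh : GenSG G h) :
      M.Invariant fun g => ⟨g.1 ∘ h, GenSG.comp g.2 hh⟩ := by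
    induction hh with
    | base hf => exact hM _ hf
    | comp ha hb iha ihb =>
      intro f hf
      exact (iha _ (hf.comp fun g => ⟨g.1 ∘ _, GenSG.comp g.2 hb⟩)).trans (ihb f hf)
  exact fun h _ => key h.1 h.2

theorem homothety_comp_comm {f g : ℂ → ℂ} (hf : f ∈ Hset) (hg : g ∈ Hset) : f ∘ g = g ∘ f := by
  obtain ⟨a, -, rfl⟩ := hf
  obtain ⟨b, -, rfl⟩ := hg
  ext z
  exact mul_left_comm a b z

theorem powerMap_comp_comm {f g : ℂ → ℂ} (hf : f ∈ Zset) (hg : g ∈ Zset) : f ∘ g = g ∘ f := by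
  obtain ⟨a, -, rfl⟩ := hf
  obtain ⟨b, -, rfl⟩ := hg
  ext z
  exact pow_right_comm z b a

theorem iterate_succ_mem {α : Type*} {U : Set (α → α)} (hUcomp : ∀ f ∈ U, ∀ g ∈ U, f ∘ g ∈ U)
    {u : α → α} (hu : u ∈ U) (n : ℕ) : u^[n + 1] ∈ U := by
  induction n with
  | zero => exact hu
  | succ n ih => exact hUcomp _ ih _ hu

/-- A power map carries a semigroup of homotheties into itself from right to left. -/
theorem exists_powerMap_comp_eq {U : Set (ℂ → ℂ)} (hU : U ⊆ Hset)
    (hUcomp : ∀ f ∈ U, ∀ g ∈ U, f ∘ g ∈ U) {t u : ℂ → ℂ} (ht : t ∈ Zset) (hu : u ∈ U) :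
    ∃ v ∈ U, t ∘ u = v ∘ t := by
  obtain ⟨n, hn, rfl⟩ := ht
  refine ⟨u^[n], ?_, ?_⟩
  · obtain ⟨k, rfl⟩ := Nat.exists_eq_add_of_le' hn
    exact iterate_succ_mem hUcomp hu k
  · obtain ⟨a, -, rfl⟩ := hU hu
    ext z
    simp [mul_pow, mul_left_iterate]

/-- If `U` is a subsemigroup of the homotheties `H` and `T` is a subsemigroup of the
power maps `Z`, then the semigroup `S = ⟨U, T⟩` generated by `U` and `T` under
composition is right amenable. -/
theorem genSG_union_rightAmenable (U T : Set (ℂ → ℂ)) (hU : U ⊆ Hset) (hT : T ⊆ Zset)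
    (hUne : U.Nonempty) (hUcomp : ∀ f ∈ U, ∀ g ∈ U, f ∘ g ∈ U)
    (hTne : T.Nonempty) (hTcomp : ∀ f ∈ T, ∀ g ∈ T, f ∘ g ∈ T) :
    ∃ M : Mean (setOf (GenSG (U ∪ T))), MapRightInv (setOf (GenSG (U ∪ T))) M := by
  obtain ⟨MU, hMU⟩ := exists_mapRightInv_of_comm hUne hUcomp
    fun f hf g hg => homothety_comp_comm (hU hf) (hU hg)
  obtain ⟨MT, hMT⟩ := exists_mapRightInv_of_comm hTne hTcomp
    fun f hf g hg => powerMap_comp_comm (hT hf) (hT hg)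
  refine ⟨MT.bind MU fun (u : U) (t : T) =>
    ⟨u.1 ∘ t.1, .comp (.base (.inl u.2)) (.base (.inr t.2))⟩, mapRightInv_genSG ?_⟩
  rintro h (hh | hh) f hf
  · change MT.toFun _ = MT.toFun _
    congr 1
    ext t
    obtain ⟨v, hv, htv⟩ := exists_powerMap_comp_eq hU hUcomp (hT t.2) hh
    refine Eq.trans ?_ (hMU ⟨v, hv⟩ (fun g => hUcomp _ g.2 _ hv) _ (hf.comp _))
    simp only [Function.comp_assoc, htv]
  · exact hMT ⟨h, hh⟩ (fun g => hTcomp _ g.2 _ hh)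
      (fun t => MU.toFun fun u => f ⟨u.1 ∘ t.1, .comp (.base (.inl u.2)) (.base (.inr t.2))⟩)
      (hf.imp fun C hC t => MU.abs_le fun u => hC _)
end
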